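/- Fix an integer N and let F_n be the free group on generators x_1,…,x_n. For each 1 ≤ k ≤ n−1 the assignments x_k ↦ x_k^N x_{k+1} x_k^{−N}, x_{k+1} ↦ x_k, and x_j ↦ x_j for j ≠ k, k+1 define an automorphism σ_k of F_n, and these automorphisms satisfy the braid relations σ_kσ_{k+1}σ_k = σ_{k+1}σ_kσ_{k+1} and σ_kσ_j = σ_jσ_k for |k−j| ≥ 2; hence they define a left action of the braid group B_n on F_n (a group homomorphism B_n → Aut(F_n)). For N = 1 this is the Artin representation. Equivalently, the endomorphism σ of F_2 given by x_1 ↦ x_1^N x_2 x_1^{−N}, x_2 ↦ x_1 is a cocartesian Yang–Baxter operator on the free group F_1 in the category of groups. -/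

import Mathlib

/-!
STATEMENT 12: For a fixed integer `N`, the assignments
`x_k ↦ x_k^N x_{k+1} x_k^{−N}`, `x_{k+1} ↦ x_k`, `x_j ↦ x_j (j ≠ k, k+1)` define
automorphisms `σ_k` of the free group `F_n` satisfying the braid relations, hence a
left action of the braid group `B_n` on `F_n` (a homomorphism `B_n → Aut(F_n)`).
-/

/-- The braid relations among the generators `σ_1, …, σ_m` (indexed by `Fin m`). -/
def braidRels (m : ℕ) : Set (FreeGroup (Fin m)) :=
  {r | (∃ i j : Fin m, (i : ℕ) + 1 = (j : ℕ) ∧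
          r = FreeGroup.of i * FreeGroup.of j * FreeGroup.of i *
              (FreeGroup.of j * FreeGroup.of i * FreeGroup.of j)⁻¹) ∨
       (∃ i j : Fin m, (i : ℕ) + 2 ≤ (j : ℕ) ∧
          r = FreeGroup.of i * FreeGroup.of j * (FreeGroup.of i)⁻¹ * (FreeGroup.of j)⁻¹)}

/-- The braid group `B_n` on `n` strands, presented with generators
`σ_1, …, σ_{n−1}` and the braid relations. -/
abbrev BraidGroup (n : ℕ) : Type := PresentedGroup (braidRels (n - 1))

/-- The standard generator `σ_i` of `B_n`. -/
def braidGen {n : ℕ} (i : Fin (n - 1)) : BraidGroup n := PresentedGroup.of i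

/-- The strand `k` (as an index in `Fin n`) on which `σ_k` acts. -/
def lo {n : ℕ} (i : Fin (n - 1)) : Fin n := ⟨i.1, by have := i.isLt; omega⟩
/-- The strand `k+1` (as an index in `Fin n`) on which `σ_k` acts. -/
def hi {n : ℕ} (i : Fin (n - 1)) : Fin n := ⟨i.1 + 1, by have := i.isLt; omega⟩

namespace FreeGroup

variable {α : Type*} [DecidableEq α]

/-- The endomorphism of the free group with `x_a ↦ x_a ^ N * x_b * x_a ^ (-N)` and `x_b ↦ x_a`
which fixes the other generators. -/
def twistHom (N : ℤ) (a b : α) : FreeGroup α →* FreeGroup α :=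
  lift fun j => if j = a then of a ^ N * of b * of a ^ (-N) else if j = b then of a else of j

/-- The inverse of `twistHom N a b` when `a ≠ b`. -/
def twistInv (N : ℤ) (a b : α) : FreeGroup α →* FreeGroup α :=
  lift fun j => if j = a then of b else if j = b then of b ^ (-N) * of a * of b ^ N else of j

theorem twistHom_left (N : ℤ) (a b : α) :
    twistHom N a b (of a) = of a ^ N * of b * of a ^ (-N) := by
  simp [twistHom]

theorem twistHom_right (N : ℤ) {a b : α} (h : a ≠ b) : twistHom N a b (of b) = of a := by
  simp [twistHom, h.symm]

theorem twistHom_of_ne (N : ℤ) {a b j : α} (ha : j ≠ a) (hb : j ≠ b) :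
    twistHom N a b (of j) = of j := by
  simp [twistHom, ha, hb]

/-- The automorphism of the free group with `x_a ↦ x_a ^ N * x_b * x_a ^ (-N)` and `x_b ↦ x_a`
which fixes the other generators. -/
def twist (N : ℤ) {a b : α} (h : a ≠ b) : FreeGroup α ≃* FreeGroup α :=
  MonoidHom.toMulEquiv (twistHom N a b) (twistInv N a b)
    (by
      ext j
      by_cases ha : j = a
      · subst ha
        simp [twistHom, twistInv, h.symm, mul_assoc]
      · by_cases hb : j = b
        · subst hb
          simp [twistHom, twistInv, h.symm]
        · simp [twistHom, twistInv, ha, hb])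
    (by
      ext j
      by_cases ha : j = a
      · subst ha
        simp [twistHom, twistInv, h.symm]
      · by_cases hb : j = b
        · subst hb
          simp [twistHom, twistInv, h.symm, mul_assoc]
        · simp [twistHom, twistInv, ha, hb])

theorem twist_apply (N : ℤ) {a b : α} (h : a ≠ b) (w : FreeGroup α) :
    twist N h w = twistHom N a b w := rfl

theorem twistHom_braid (N : ℤ) {a b c : α} (hab : a ≠ b) (hbc : b ≠ c) (hac : a ≠ c) :
    (twistHom N a b).comp ((twistHom N b c).comp (twistHom N a b)) =
      (twistHom N b c).comp ((twistHom N a b).comp (twistHom N b c)) := by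
  ext j
  by_cases ha : j = a
  · subst ha
    simp [twistHom, hab, hab.symm, hac, hac.symm, hbc.symm, conj_zpow]
    group
  by_cases hb : j = b
  · subst hb
    simp [twistHom, hab, hab.symm, hac, hac.symm, hbc.symm]
  by_cases hc : j = c
  · subst hc
    simp [twistHom, hab, hab.symm, hac, hac.symm, hbc.symm]
  simp [twistHom, ha, hb, hc]

theorem twistHom_comm (N : ℤ) {a b c d : α} (hac : a ≠ c) (had : a ≠ d) (hbc : b ≠ c)
    (hbd : b ≠ d) :
    (twistHom N a b).comp (twistHom N c d) = (twistHom N c d).comp (twistHom N a b) := by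
  ext j
  simp only [twistHom, MonoidHom.comp_apply, lift_apply_of]
  split_ifs <;> simp_all [eq_comm]

end FreeGroup

theorem lo_ne_hi {n : ℕ} (i : Fin (n - 1)) : lo i ≠ hi i := by
  simp [lo, hi]

theorem statement12 (N : ℤ) (n : ℕ) :
    ∃ σ : Fin (n - 1) → (FreeGroup (Fin n) ≃* FreeGroup (Fin n)),
      -- the defining assignments
      (∀ k : Fin (n - 1),
        σ k (FreeGroup.of (lo k)) =
          (FreeGroup.of (lo k)) ^ N * FreeGroup.of (hi k) * (FreeGroup.of (lo k)) ^ (-N) ∧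
        σ k (FreeGroup.of (hi k)) = FreeGroup.of (lo k) ∧
        ∀ j : Fin n, j ≠ lo k → j ≠ hi k → σ k (FreeGroup.of j) = FreeGroup.of j) ∧
      -- the braid relations
      (∀ k l : Fin (n - 1), (k : ℕ) + 1 = (l : ℕ) →
        ∀ w, σ k (σ l (σ k w)) = σ l (σ k (σ l w))) ∧
      (∀ k l : Fin (n - 1), (k : ℕ) + 2 ≤ (l : ℕ) →
        ∀ w, σ k (σ l w) = σ l (σ k w)) ∧
      -- hence a left action of B_n on F_n
      ∃ ρ : BraidGroup n →* MulAut (FreeGroup (Fin n)),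
        ∀ k : Fin (n - 1), ρ (braidGen k) = σ k := by
  have braid : ∀ k l : Fin (n - 1), (k : ℕ) + 1 = (l : ℕ) → ∀ w,
      FreeGroup.twist N (lo_ne_hi k) (FreeGroup.twist N (lo_ne_hi l)
          (FreeGroup.twist N (lo_ne_hi k) w)) =
        FreeGroup.twist N (lo_ne_hi l) (FreeGroup.twist N (lo_ne_hi k)
          (FreeGroup.twist N (lo_ne_hi l) w)) := by
    intro k l hkl w
    have hlk : lo l = hi k := Fin.ext hkl.symm
    have hac : lo k ≠ hi l := by simp only [lo, hi, ne_eq, Fin.mk.injEq]; omega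
    simp only [FreeGroup.twist_apply]
    have h := FreeGroup.twistHom_braid N (lo_ne_hi k) (hlk ▸ lo_ne_hi l) hac
    rw [← hlk] at h ⊢
    exact DFunLike.congr_fun h w
  have comm : ∀ k l : Fin (n - 1), (k : ℕ) + 2 ≤ (l : ℕ) → ∀ w,
      FreeGroup.twist N (lo_ne_hi k) (FreeGroup.twist N (lo_ne_hi l) w) =
        FreeGroup.twist N (lo_ne_hi l) (FreeGroup.twist N (lo_ne_hi k) w) := by
    intro k l hkl w
    refine DFunLike.congr_fun (FreeGroup.twistHom_comm N ?_ ?_ ?_ ?_) w <;>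
      simp only [lo, hi, ne_eq, Fin.mk.injEq] <;> omega
  refine ⟨fun k => FreeGroup.twist N (lo_ne_hi k), fun k => ⟨FreeGroup.twistHom_left N _ _,
    FreeGroup.twistHom_right N (lo_ne_hi k), fun j => FreeGroup.twistHom_of_ne N⟩, braid, comm,
    PresentedGroup.toGroup (G := MulAut (FreeGroup (Fin n)))
      (f := fun k => FreeGroup.twist N (lo_ne_hi k)) ?_, fun k => PresentedGroup.toGroup.of _⟩
  rintro r (⟨i, j, hij, rfl⟩ | ⟨i, j, hij, rfl⟩)
  · simp only [map_mul, map_inv, FreeGroup.lift_apply_of]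
    rw [mul_inv_eq_one]
    exact MulEquiv.ext (braid i j hij)
  · simp only [map_mul, map_inv, FreeGroup.lift_apply_of]
    rw [mul_inv_eq_one, mul_inv_eq_iff_eq_mul]
    exact MulEquiv.ext (comm i j hij)
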